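/- (Proposition 2, single data point.) Fix y ∈ ℝ, μ ∈ ℝ, σ² > 0, and an integer N ≥ 4. Let X₁, …, X_N be i.i.d. samples from the Gaussian distribution N(μ, σ²), and define the sample mean μ̂ = (1/N) ∑_{i=1}^{N} X_i and sample variance σ̂² = (1/(N−1)) ∑_{i=1}^{N} (X_i − μ̂)². Writing p(y | m, v) = (2πv)^{−1/2} exp(−(y−m)²/(2v)) for the Gaussian density, the expected plug-in log-likelihood lower-bounds the true log-likelihood: E[log p(y | μ̂, σ̂²)] ≤ log p(y | μ, σ²). -/

import Mathlib

open MeasureTheory ProbabilityTheory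

/-- The Gaussian density `p(y | m, v) = (2πv)^{-1/2} exp (-(y-m)²/(2v))`. -/
noncomputable def gaussDensity (y m v : ℝ) : ℝ :=
  (Real.sqrt (2 * Real.pi * v))⁻¹ * Real.exp (-(y - m) ^ 2 / (2 * v))

theorem stdGaussian_eq_withDensity {E : Type*} [NormedAddCommGroup E] [InnerProductSpace ℝ E]
    [FiniteDimensional ℝ E] [MeasurableSpace E] [BorelSpace E] :
    stdGaussian E = (volume : Measure E).withDensity fun x =>
      ENNReal.ofReal (((2 * Real.pi) ^ (Module.finrank ℝ E / 2 : ℝ))⁻¹ *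
        Real.exp (-(1 / 2) * ‖x‖ ^ 2)) := by
  have hint : Integrable (fun x : E => ((2 * Real.pi) ^ (Module.finrank ℝ E / 2 : ℝ))⁻¹ *
      Real.exp (-(1 / 2) * ‖x‖ ^ 2)) := by
    refine Integrable.const_mul ?_ _
    have h := (GaussianFourier.integrable_cexp_neg_mul_sq_norm_add (V := E) (b := 1 / 2)
      (by norm_num) 0 0).re
    refine h.congr (ae_of_all _ fun x => ?_)
    simp only [zero_mul, add_zero]
    rw [← Complex.exp_ofReal_re]
    norm_num
  have := isFiniteMeasure_withDensity_ofReal hint.2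
  refine Measure.ext_of_charFun (funext fun t => ?_)
  rw [charFun_stdGaussian, charFun_apply, integral_withDensity_eq_integral_toReal_smul
    (by fun_prop) (by simp)]
  have h := GaussianFourier.integral_cexp_neg_mul_sq_norm_add (V := E) (b := 1 / 2)
      (by norm_num) Complex.I t
  have hpi : ((Real.pi : ℂ) / (1 / 2)) ^ (Module.finrank ℝ E / 2 : ℂ)
      = (((2 * Real.pi) ^ (Module.finrank ℝ E / 2 : ℝ) : ℝ) : ℂ) := by
    rw [Complex.ofReal_cpow (by positivity)]
    push_cast
    congr 1
    ring
  calc Complex.exp (-‖t‖ ^ 2 / 2)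
      = (((2 * Real.pi) ^ (Module.finrank ℝ E / 2 : ℝ) : ℝ) : ℂ)⁻¹ *
        ∫ v : E, Complex.exp (-(1 / 2) * ‖v‖ ^ 2 + Complex.I * inner ℝ t v) := by
        rw [h, hpi, inv_mul_cancel_left₀]
        · congr 1
          rw [Complex.I_sq]
          ring
        · exact_mod_cast
            (by positivity : (0 : ℝ) < (2 * Real.pi) ^ (Module.finrank ℝ E / 2 : ℝ)).ne'
    _ = _ := by
        rw [← integral_const_mul]
        refine integral_congr_ae (ae_of_all _ fun x => ?_)
        dsimp only
        rw [ENNReal.toReal_ofReal (by positivity), Complex.real_smul, Complex.exp_add,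
          real_inner_comm]
        push_cast
        ring_nf

section
variable {E : Type*} [NormedAddCommGroup E] [InnerProductSpace ℝ E]
    [FiniteDimensional ℝ E] [MeasurableSpace E] [BorelSpace E]

theorem integrable_norm_rpow_stdGaussian [Nontrivial E] {s : ℝ}
    (hs : 0 < Module.finrank ℝ E + s) :
    Integrable (fun x : E => ‖x‖ ^ s) (stdGaussian E) := by
  rw [stdGaussian_eq_withDensity, integrable_withDensity_iff_integrable_smul' (by fun_prop)
    (by simp), integrable_fun_norm_addHaar volume (f := fun r : ℝ => (ENNReal.ofReal
      (((2 * Real.pi) ^ (Module.finrank ℝ E / 2 : ℝ))⁻¹ *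
        Real.exp (-(1 / 2) * r ^ 2))).toReal • r ^ s)]
  have h := (integrableOn_rpow_mul_exp_neg_mul_sq (b := 1 / 2) (by norm_num)
    (s := Module.finrank ℝ E + s - 1) (by linarith)).const_mul
      (((2 * Real.pi) ^ (Module.finrank ℝ E / 2 : ℝ))⁻¹)
  refine IntegrableOn.congr_fun h (fun r hr => ?_) measurableSet_Ioi
  have hr : 0 < r := hr
  have hd : 1 ≤ Module.finrank ℝ E := Module.finrank_pos
  simp only [smul_eq_mul]
  rw [ENNReal.toReal_ofReal (by positivity), show (Module.finrank ℝ E + s - 1 : ℝ)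
    = ((Module.finrank ℝ E - 1 : ℕ) : ℝ) + s by push_cast [hd]; ring, Real.rpow_add hr,
    Real.rpow_natCast]
  ring

theorem integral_norm_rpow_stdGaussian [Nontrivial E] {s : ℝ}
    (hs : 0 < Module.finrank ℝ E + s) :
    ∫ x : E, ‖x‖ ^ s ∂stdGaussian E =
      2 ^ (s / 2) * Real.Gamma ((Module.finrank ℝ E + s) / 2) /
        Real.Gamma (Module.finrank ℝ E / 2) := by
  have hd : 1 ≤ Module.finrank ℝ E := Module.finrank_pos
  have hd' : (1 : ℝ) ≤ Module.finrank ℝ E := by exact_mod_cast hd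
  obtain ⟨K, hK⟩ : ∃ K : ℝ, ∀ s : ℝ, 0 < Module.finrank ℝ E + s →
      ∫ x : E, ‖x‖ ^ s ∂stdGaussian E =
        K * (2 ^ (s / 2) * Real.Gamma ((Module.finrank ℝ E + s) / 2)) := by
    refine ⟨(Module.finrank ℝ E * (volume : Measure E).real (Metric.ball 0 1)) *
      (((2 * Real.pi) ^ (Module.finrank ℝ E / 2 : ℝ))⁻¹ *
        (2 ^ (Module.finrank ℝ E / 2 : ℝ) * (1 / 2))), fun s hs => ?_⟩
    rw [stdGaussian_eq_withDensity, integral_withDensity_eq_integral_toReal_smul (by fun_prop)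
      (by simp), integral_fun_norm_addHaar volume (f := fun r : ℝ => (ENNReal.ofReal
        (((2 * Real.pi) ^ (Module.finrank ℝ E / 2 : ℝ))⁻¹ *
          Real.exp (-(1 / 2) * r ^ 2))).toReal • r ^ s)]
    have h := integral_rpow_mul_exp_neg_mul_rpow (b := 1 / 2) (p := 2)
      (q := Module.finrank ℝ E + s - 1) (by norm_num) (by linarith) (by norm_num)
    have h2 : (1 / 2 : ℝ) ^ (-(Module.finrank ℝ E + s - 1 + 1) / 2 : ℝ) =
        2 ^ (Module.finrank ℝ E / 2 : ℝ) * 2 ^ (s / 2) := by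
      rw [← Real.rpow_add two_pos, one_div, Real.inv_rpow two_pos.le,
        ← Real.rpow_neg two_pos.le]
      congr 1
      ring
    rw [h2, sub_add_cancel] at h
    rw [nsmul_eq_mul, smul_eq_mul, mul_assoc, mul_assoc, mul_assoc, mul_assoc]
    congr 2
    trans ∫ r in Set.Ioi (0 : ℝ), ((2 * Real.pi) ^ (Module.finrank ℝ E / 2 : ℝ))⁻¹ *
      (r ^ (Module.finrank ℝ E + s - 1 : ℝ) * Real.exp (-(1 / 2) * r ^ (2 : ℝ)))
    · refine setIntegral_congr_fun measurableSet_Ioi (fun r hr => ?_)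
      have hr : 0 < r := hr
      simp only [smul_eq_mul]
      rw [ENNReal.toReal_ofReal (by positivity), show (Module.finrank ℝ E + s - 1 : ℝ)
        = ((Module.finrank ℝ E - 1 : ℕ) : ℝ) + s by push_cast [hd]; ring, Real.rpow_add hr,
        Real.rpow_natCast, Real.rpow_two]
      ring
    · rw [integral_const_mul, h]
      ring
  have h0 := hK 0 (by linarith)
  simp only [Real.rpow_zero, integral_const, probReal_univ, smul_eq_mul, zero_div, add_zero,
    mul_one, one_mul] at h0
  have hG : Real.Gamma (Module.finrank ℝ E / 2) ≠ 0 := (Real.Gamma_pos_of_pos (by linarith)).ne'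
  rw [hK s hs, eq_div_iff hG]
  linear_combination (-(2 ^ (s / 2) * Real.Gamma ((Module.finrank ℝ E + s) / 2))) * h0

theorem integral_norm_rpow_add_two_stdGaussian [Nontrivial E] {s : ℝ}
    (hs : 0 < Module.finrank ℝ E + s) :
    ∫ x : E, ‖x‖ ^ (s + 2) ∂stdGaussian E =
      (Module.finrank ℝ E + s) * ∫ x : E, ‖x‖ ^ s ∂stdGaussian E := by
  rw [integral_norm_rpow_stdGaussian hs, integral_norm_rpow_stdGaussian (by linarith),
    show (s + 2) / 2 = s / 2 + 1 by ring, Real.rpow_add_one two_ne_zero,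
    show (Module.finrank ℝ E + (s + 2)) / 2 = (Module.finrank ℝ E + s) / 2 + 1 by ring,
    Real.Gamma_add_one (by linarith)]
  ring

end

theorem exists_measurePreserving_sum_eq (k : ℕ) :
    ∃ Φ : ℝ × EuclideanSpace ℝ (Fin k) → (Fin (k + 1) → ℝ),
      MeasurePreserving Φ ((gaussianReal 0 1).prod (stdGaussian (EuclideanSpace ℝ (Fin k))))
        (Measure.pi fun _ => gaussianReal 0 1) ∧
      (∀ p, ∑ i, Φ p i = √(k + 1) * p.1) ∧ ∀ p, ∑ i, Φ p i ^ 2 = p.1 ^ 2 + ‖p.2‖ ^ 2 := by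
  obtain ⟨b, hb⟩ : ∃ b : OrthonormalBasis (Fin (k + 1)) ℝ (EuclideanSpace ℝ (Fin (k + 1))),
      b 0 = WithLp.toLp 2 fun _ => (√(k + 1))⁻¹ := by
    have hv : Orthonormal ℝ (({0} : Set (Fin (k + 1))).domRestrict fun _ =>
        (WithLp.toLp 2 fun _ => (√(k + 1))⁻¹ : EuclideanSpace ℝ (Fin (k + 1)))) := by
      rw [orthonormal_subsingleton_iff]
      intro _
      have : (0 : ℝ) < k + 1 := by positivity
      simp [EuclideanSpace.norm_eq, Real.sq_sqrt this.le, this.ne']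
    obtain ⟨b, hb⟩ := hv.exists_orthonormalBasis_extension_of_card_eq (by simp)
    exact ⟨b, hb 0 rfl⟩
  have hT : MeasurePreserving (fun x : Fin (k + 1) → ℝ => WithLp.ofLp (∑ i, x i • b i))
      (Measure.pi fun _ => gaussianReal 0 1) (Measure.pi fun _ => gaussianReal 0 1) := by
    refine ⟨by fun_prop, ?_⟩
    have h := (stdGaussian_eq_map_pi_orthonormalBasis b).symm.trans map_pi_eq_stdGaussian.symm
    have h' := congrArg (Measure.map (WithLp.ofLp (p := 2))) h
    rw [Measure.map_map (by fun_prop) (by fun_prop), Measure.map_map (by fun_prop) (by fun_prop)]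
      at h'
    exact h'.trans Measure.map_id
  have hL : MeasurePreserving (WithLp.ofLp (p := 2) (V := Fin k → ℝ))
      (stdGaussian (EuclideanSpace ℝ (Fin k))) (Measure.pi fun _ => gaussianReal 0 1) := by
    refine ⟨by fun_prop, ?_⟩
    rw [← map_pi_eq_stdGaussian, Measure.map_map (by fun_prop) (by fun_prop)]
    exact Measure.map_id
  have hS := (measurePreserving_piFinSuccAbove (fun _ : Fin (k + 1) => gaussianReal 0 1) 0).symm
  refine ⟨_, hT.comp (hS.comp ((MeasurePreserving.id _).prod hL)), fun p => ?_, fun p => ?_⟩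
  · set x := (MeasurableEquiv.piFinSuccAbove (fun _ : Fin (k + 1) => ℝ) 0).symm (p.1, p.2.ofLp)
      with hx
    have h : inner ℝ (b 0) (∑ i, x i • b i) = p.1 := by
      rw [b.orthonormal.inner_right_fintype, hx]
      rfl
    rw [hb] at h
    simp only [PiLp.inner_apply, RCLike.inner_apply, conj_trivial, ← Finset.sum_mul] at h
    have hk : √(k + 1 : ℝ) ≠ 0 := by positivity
    change ∑ i, (∑ i, x i • b i : EuclideanSpace ℝ (Fin (k + 1))) i = _
    rw [← h]
    field_simp
  · set x := (MeasurableEquiv.piFinSuccAbove (fun _ : Fin (k + 1) => ℝ) 0).symm (p.1, p.2.ofLp)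
      with hx
    change ∑ i, (∑ i, x i • b i : EuclideanSpace ℝ (Fin (k + 1))) i ^ 2 = _
    rw [← EuclideanSpace.real_norm_sq_eq, EuclideanSpace.real_norm_sq_eq p.2,
      ← b.sum_sq_norm_inner_right]
    simp_rw [b.orthonormal.inner_right_fintype, Real.norm_eq_abs, sq_abs]
    rw [Fin.sum_univ_succ]
    rfl

theorem neg_log_le_rational {q : ℝ} (hq : 0 < q) :
    -Real.log q ≤ q ^ 4 / 20 - q ^ 3 / 3 + q ^ 2 - 2 * q + q⁻¹ / 5 + 13 / 12 := by
  let f : ℝ → ℝ := fun q =>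
    q ^ 4 / 20 - q ^ 3 / 3 + q ^ 2 - 2 * q + q⁻¹ / 5 + 13 / 12 + Real.log q
  have hd : ∀ x : ℝ, 0 < x → HasDerivAt f ((x - 1) ^ 5 / (5 * x ^ 2)) x := by
    intro x hx
    have h := (((((((hasDerivAt_pow 4 x).div_const 20).sub
      ((hasDerivAt_pow 3 x).div_const 3)).add (hasDerivAt_pow 2 x)).sub
      ((hasDerivAt_id x).const_mul 2)).add ((hasDerivAt_inv hx.ne').div_const 5)).add_const
      (13 / 12)).add (Real.hasDerivAt_log hx.ne')
    refine h.congr_deriv ?_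
    push_cast
    field_simp
    ring
  have h1 : f 1 = 0 := by simp [f]; norm_num
  suffices 0 ≤ f q by simp only [f] at this; linarith
  rcases le_total q 1 with h | h
  · have : AntitoneOn f (Set.Icc q 1) := by
      refine antitoneOn_of_deriv_nonpos (convex_Icc _ _)
        (fun x hx => (hd x (hq.trans_le hx.1)).continuousAt.continuousWithinAt) ?_ ?_ <;>
        rw [interior_Icc] <;> intro x hx
      · exact (hd x (hq.trans hx.1)).differentiableAt.differentiableWithinAt
      · rw [(hd x (hq.trans hx.1)).deriv]
        exact div_nonpos_of_nonpos_of_nonneg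
          (Odd.pow_nonpos (by decide) (by linarith [hx.2])) (by positivity)
    exact h1 ▸ this (Set.left_mem_Icc.2 h) (Set.right_mem_Icc.2 h) h
  · have : MonotoneOn f (Set.Icc 1 q) := by
      refine monotoneOn_of_deriv_nonneg (convex_Icc _ _)
        (fun x hx => (hd x (one_pos.trans_le hx.1)).continuousAt.continuousWithinAt) ?_ ?_ <;>
        rw [interior_Icc] <;> intro x hx
      · exact (hd x (one_pos.trans hx.1)).differentiableAt.differentiableWithinAt
      · rw [(hd x (one_pos.trans hx.1)).deriv]
        exact div_nonneg (pow_nonneg (by linarith [hx.1]) _) (by positivity)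
    exact h1 ▸ this (Set.left_mem_Icc.2 h) (Set.right_mem_Icc.2 h) h

theorem log_gaussDensity (y m : ℝ) {v : ℝ} (hv : 0 < v) :
    Real.log (gaussDensity y m v) = -Real.log (2 * Real.pi * v) / 2 - (y - m) ^ 2 / (2 * v) := by
  have h : 0 < 2 * Real.pi * v := by positivity
  rw [gaussDensity, Real.log_mul (by positivity) (Real.exp_ne_zero _), Real.log_exp, Real.log_inv,
    Real.log_sqrt h.le]
  ring

theorem integral_sub_mul_sq_gaussianReal (d c : ℝ) :
    Integrable (fun m => (d - c * m) ^ 2) (gaussianReal 0 1) ∧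
      ∫ m, (d - c * m) ^ 2 ∂gaussianReal 0 1 = d ^ 2 + c ^ 2 := by
  have h2 : MemLp (fun m => d - c * m) 2 (gaussianReal 0 1) :=
    (memLp_const d).sub ((memLp_id_gaussianReal 2).const_mul c)
  have hi : Integrable (fun m : ℝ => m) (gaussianReal 0 1) :=
    memLp_one_iff_integrable.1 (memLp_id_gaussianReal 1)
  refine ⟨h2.integrable_sq, ?_⟩
  have hmean : ∫ m, (d - c * m) ∂gaussianReal 0 1 = d := by
    rw [integral_sub (integrable_const _) (hi.const_mul c), integral_const_mul,
      integral_id_gaussianReal]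
    simp
  have hvar : variance (fun m => d - c * m) (gaussianReal 0 1) = c ^ 2 := by
    rw [variance_const_sub (by fun_prop), variance_const_mul, variance_fun_id_gaussianReal]
    simp
  have h := variance_eq_sub h2
  rw [hvar, hmean] at h
  simp only [Pi.pow_apply] at h
  linarith

theorem integrable_integral_norm_pow_stdGaussian {k : ℕ} (hk : 0 < k) (j : ℕ) :
    Integrable (fun x : EuclideanSpace ℝ (Fin k) => (‖x‖ ^ 2) ^ j)
        (stdGaussian (EuclideanSpace ℝ (Fin k))) ∧
      ∫ x, (‖x‖ ^ 2) ^ j ∂stdGaussian (EuclideanSpace ℝ (Fin k)) =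
        ∏ i ∈ Finset.range j, (k + 2 * i : ℝ) := by
  have : Nonempty (Fin k) := ⟨⟨0, hk⟩⟩
  have hpow : ∀ j : ℕ, (fun x : EuclideanSpace ℝ (Fin k) => (‖x‖ ^ 2) ^ j) =
      fun x => ‖x‖ ^ (2 * j : ℝ) := by
    intro j
    funext x
    rw [← pow_mul, ← Real.rpow_natCast]
    push_cast
    rfl
  have hpos : ∀ j : ℕ, (0 : ℝ) < Module.finrank ℝ (EuclideanSpace ℝ (Fin k)) + 2 * j := by
    intro j
    rw [finrank_euclideanSpace_fin]
    positivity
  refine ⟨?_, ?_⟩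
  · rw [hpow]
    exact integrable_norm_rpow_stdGaussian (hpos j)
  · induction j with
    | zero => simp
    | succ j ih =>
      rw [hpow] at ih ⊢
      push_cast
      rw [mul_add, mul_one, integral_norm_rpow_add_two_stdGaussian (hpos j), ih,
        Finset.prod_range_succ, finrank_euclideanSpace_fin, mul_comm]

theorem integrable_integral_inv_norm_sq_stdGaussian {k : ℕ} (hk : 2 < k) :
    Integrable (fun x : EuclideanSpace ℝ (Fin k) => (‖x‖ ^ 2)⁻¹)
        (stdGaussian (EuclideanSpace ℝ (Fin k))) ∧
      ∫ x, (‖x‖ ^ 2)⁻¹ ∂stdGaussian (EuclideanSpace ℝ (Fin k)) = (k - 2 : ℝ)⁻¹ := by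
  have : Nonempty (Fin k) := ⟨⟨0, by lia⟩⟩
  have hk' : (2 : ℝ) < k := by exact_mod_cast hk
  have hpow : (fun x : EuclideanSpace ℝ (Fin k) => (‖x‖ ^ 2)⁻¹) = fun x => ‖x‖ ^ (-2 : ℝ) := by
    funext x
    rw [Real.rpow_neg (norm_nonneg _), Real.rpow_two]
  have hpos : (0 : ℝ) < Module.finrank ℝ (EuclideanSpace ℝ (Fin k)) + (-2) := by
    rw [finrank_euclideanSpace_fin]
    linarith
  rw [hpow]
  refine ⟨integrable_norm_rpow_stdGaussian hpos, eq_inv_of_mul_eq_one_right ?_⟩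
  have h := integral_norm_rpow_add_two_stdGaussian hpos
  rw [finrank_euclideanSpace_fin] at h
  rw [sub_eq_add_neg, ← h]
  simp

theorem integrable_integral_rational_norm_sq_stdGaussian_le {k : ℕ} (hk : 2 < k)
    {P : ℝ → ℝ}
    (hP : P = fun q => q ^ 4 / 20 - q ^ 3 / 3 + q ^ 2 - 2 * q + q⁻¹ / 5 + 13 / 12) :
    Integrable (fun x : EuclideanSpace ℝ (Fin k) => P (‖x‖ ^ 2 / k))
        (stdGaussian (EuclideanSpace ℝ (Fin k))) ∧
      ∫ x, P (‖x‖ ^ 2 / k) ∂stdGaussian (EuclideanSpace ℝ (Fin k)) ≤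
        k / ((k + 1) * (k - 2)) := by
  have hk' : (3 : ℝ) ≤ k := by exact_mod_cast hk
  have hk0 : (0 : ℝ) < k := by linarith
  have hk2 : (0 : ℝ) < k - 2 := by linarith
  have hPk : (fun x : EuclideanSpace ℝ (Fin k) => P (‖x‖ ^ 2 / k)) = fun x =>
      (20 * k ^ 4 : ℝ)⁻¹ * (‖x‖ ^ 2) ^ 4 + -(3 * k ^ 3 : ℝ)⁻¹ * (‖x‖ ^ 2) ^ 3
        + (k ^ 2 : ℝ)⁻¹ * (‖x‖ ^ 2) ^ 2 + -(2 * (k : ℝ)⁻¹) * (‖x‖ ^ 2) ^ 1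
        + (k / 5 : ℝ) * (‖x‖ ^ 2)⁻¹ + 13 / 12 := by
    funext x
    simp only [hP, inv_div, div_pow, pow_one, mul_inv]
    ring
  have h n := integrable_integral_norm_pow_stdGaussian (k := k) (by lia) n
  obtain ⟨hi, hi'⟩ := integrable_integral_inv_norm_sq_stdGaussian hk
  rw [hPk]
  have i4 := (h 4).1.const_mul (20 * k ^ 4 : ℝ)⁻¹
  have i3 := (h 3).1.const_mul (-(3 * k ^ 3 : ℝ)⁻¹)
  have i2 := (h 2).1.const_mul (k ^ 2 : ℝ)⁻¹
  have i1 := (h 1).1.const_mul (-(2 * (k : ℝ)⁻¹))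
  have ii := hi.const_mul (k / 5 : ℝ)
  have i43 := i4.fun_add i3
  have i42 := i43.fun_add i2
  have i41 := i42.fun_add i1
  have i4i := i41.fun_add ii
  refine ⟨i4i.add (integrable_const _), ?_⟩
  rw [integral_add i4i (integrable_const _), integral_add i41 ii, integral_add i42 i1,
    integral_add i43 i2, integral_add i4 i3]
  simp only [integral_const_mul, (h _).2, hi', integral_const, probReal_univ, one_smul,
    Finset.prod_range_succ, Finset.prod_range_zero]
  push_cast
  rw [le_div_iff₀ (by positivity), ← sub_nonneg]
  obtain ⟨t, ht, hkt⟩ : ∃ t : ℝ, 0 ≤ t ∧ (k : ℝ) = t + 3 := ⟨k - 3, by linarith, by ring⟩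
  have key : 0 ≤ (40 * (k : ℝ) ^ 3 - 100 * k ^ 2 + 88 * k + 288) / (60 * k ^ 3) := by
    refine div_nonneg ?_ (by positivity)
    rw [hkt]
    ring_nf
    positivity
  refine key.trans_eq ?_
  field_simp
  ring

theorem abs_log_le_add_inv {q : ℝ} (hq : 0 < q) : |Real.log q| ≤ q + q⁻¹ := by
  have h1 := Real.log_le_sub_one_of_pos hq
  have h2 := Real.log_le_sub_one_of_pos (inv_pos.2 hq)
  have h3 := inv_pos.2 hq
  rw [Real.log_inv] at h2
  rw [abs_le]
  constructor <;> linarith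

theorem ae_norm_sq_pos_stdGaussian {k : ℕ} (hk : 0 < k) :
    ∀ᵐ x ∂stdGaussian (EuclideanSpace ℝ (Fin k)), 0 < ‖x‖ ^ 2 := by
  have : Nonempty (Fin k) := ⟨⟨0, hk⟩⟩
  rw [stdGaussian_eq_withDensity]
  refine (withDensity_absolutelyContinuous _ _).ae_le ?_
  filter_upwards [Measure.ae_ne volume (0 : EuclideanSpace ℝ (Fin k))] with x hx
  positivity

theorem integrable_log_norm_sq_div_stdGaussian {k : ℕ} (hk : 2 < k) :
    Integrable (fun x : EuclideanSpace ℝ (Fin k) => Real.log (‖x‖ ^ 2 / k))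
      (stdGaussian (EuclideanSpace ℝ (Fin k))) := by
  have hk0 : (0 : ℝ) < k := by exact_mod_cast (by lia : 0 < k)
  have h := (integrable_integral_norm_pow_stdGaussian (k := k) (by lia) 1).1
  refine Integrable.mono' ((h.div_const (k : ℝ)).add ((integrable_integral_inv_norm_sq_stdGaussian hk).1.const_mul (k : ℝ)))
    (Measurable.aestronglyMeasurable (by fun_prop)) ?_
  filter_upwards [ae_norm_sq_pos_stdGaussian (k := k) (by lia)] with x hx
  refine (abs_log_le_add_inv (div_pos hx hk0)).trans_eq ?_
  simp [div_eq_mul_inv, mul_comm]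

theorem measurePreserving_const_add_mul_gaussianReal (μ : ℝ) (v : NNReal) :
    MeasurePreserving (fun x => μ + √v * x) (gaussianReal 0 1) (gaussianReal μ v) := by
  refine ⟨by fun_prop, ?_⟩
  rw [show (fun x => μ + √v * x) = (fun x => μ + x) ∘ (fun x => √v * x) from rfl,
    ← Measure.map_map (by fun_prop) (by fun_prop), gaussianReal_map_const_mul,
    gaussianReal_map_const_add]
  congr 1
  · simp
  · ext
    simp

theorem sum_sub_mean_sq {n : ℕ} (hn : n ≠ 0) (x : Fin n → ℝ) :
    ∑ i, (x i - (∑ j, x j) / n) ^ 2 = ∑ i, x i ^ 2 - (∑ i, x i) ^ 2 / n := by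
  have hn' : (n : ℝ) ≠ 0 := by exact_mod_cast hn
  simp only [sub_sq, Finset.sum_add_distrib, Finset.sum_sub_distrib, ← Finset.sum_mul,
    ← Finset.mul_sum, Finset.sum_const, Finset.card_univ, Fintype.card_fin, nsmul_eq_mul]
  field_simp
  ring

theorem exists_measurePreserving_mean_variance (μ : ℝ) (v : NNReal) (k : ℕ) :
    ∃ Ψ : ℝ × EuclideanSpace ℝ (Fin k) → (Fin (k + 1) → ℝ),
      MeasurePreserving Ψ ((gaussianReal 0 1).prod (stdGaussian (EuclideanSpace ℝ (Fin k))))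
        (Measure.pi fun _ => gaussianReal μ v) ∧
      ∀ p, (∑ i, Ψ p i) / (k + 1 : ℕ) = μ + √v / √(k + 1) * p.1 ∧
        ∑ i, (Ψ p i - (∑ j, Ψ p j) / (k + 1 : ℕ)) ^ 2 = v * ‖p.2‖ ^ 2 := by
  obtain ⟨Φ, hΦ, hsum, hsq⟩ := exists_measurePreserving_sum_eq k
  have hk : (0 : ℝ) < k + 1 := by positivity
  have hk' := Real.sq_sqrt hk.le
  have hsk : 0 < √(k + 1 : ℝ) := by positivity
  have hA := measurePreserving_pi (fun _ : Fin (k + 1) => gaussianReal 0 1)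
    (fun _ => gaussianReal μ v) fun _ => measurePreserving_const_add_mul_gaussianReal μ v
  have hmean : ∀ p, (∑ i, (μ + √v * Φ p i)) / (k + 1 : ℕ) = μ + √v / √(k + 1) * p.1 := by
    intro p
    simp only [Finset.sum_add_distrib, ← Finset.mul_sum, hsum, Finset.sum_const, Finset.card_univ,
      Fintype.card_fin, nsmul_eq_mul]
    push_cast
    rw [div_eq_iff hk.ne']
    field_simp
    linear_combination √v * p.1 * hk'
  refine ⟨_, hA.comp hΦ, fun p => ⟨hmean p, ?_⟩⟩
  trans ∑ i, (√v * (Φ p i - (∑ j, Φ p j) / (k + 1 : ℕ))) ^ 2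
  · refine Finset.sum_congr rfl fun i _ => ?_
    rw [hsum]
    change (μ + √v * Φ p i - (∑ j, (μ + √v * Φ p j)) / (k + 1 : ℕ)) ^ 2 = _
    rw [hmean]
    push_cast
    rw [show √(k + 1 : ℝ) * p.1 / (k + 1) = p.1 / √(k + 1 : ℝ) by
      rw [div_eq_div_iff hk.ne' hsk.ne']; linear_combination p.1 * hk']
    ring
  · simp only [mul_pow, ← Finset.mul_sum]
    rw [sum_sub_mean_sq (by lia), hsum, hsq, mul_pow, Real.sq_sqrt v.coe_nonneg, hk']
    push_cast
    field_simp
    ring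

/-- Proposition 2, single data point: for `y, μ ∈ ℝ`, `σ² > 0` and `N ≥ 4`,
with `X₁,…,X_N` i.i.d. samples from `N(μ, σ²)` (modelled by the `N`-fold product of the
Gaussian measure), sample mean `μ̂` and sample variance `σ̂²`, the expected plug-in
log-likelihood lower bounds the true log-likelihood:
`E[log p(y | μ̂, σ̂²)] ≤ log p(y | μ, σ²)`. -/
theorem expected_plugin_log_likelihood_le
    (y μ : ℝ) (v : NNReal) (hv : 0 < v) (N : ℕ) (hN : 4 ≤ N) :
    (∫ X : Fin N → ℝ,
        Real.log (gaussDensity y ((∑ i, X i) / N)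
          ((∑ i, (X i - (∑ i', X i') / N) ^ 2) / ((N : ℝ) - 1)))
        ∂(Measure.pi fun _ : Fin N => gaussianReal μ v))
      ≤ Real.log (gaussDensity y μ (v : ℝ)) := by
  obtain ⟨k, rfl⟩ : ∃ k, N = k + 1 := ⟨N - 1, by lia⟩
  have hk : 2 < k := by lia
  have hk2 : (0 : ℝ) < k - 2 := by
    have : (2 : ℝ) < k := by exact_mod_cast hk
    linarith
  have hk0 : (0 : ℝ) < k := by linarith
  have hv' : (0 : ℝ) < v := hv
  obtain ⟨Ψ, hΨ, hstat⟩ := exists_measurePreserving_mean_variance μ v k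
  set γ := stdGaussian (EuclideanSpace ℝ (Fin k))
  set c : ℝ := √v / √(k + 1) with hc
  have hc2 : c ^ 2 = v / (k + 1) := by
    rw [hc, div_pow, Real.sq_sqrt v.coe_nonneg, Real.sq_sqrt (by positivity)]
  obtain ⟨hq, hq'⟩ := integral_sub_mul_sq_gaussianReal (y - μ) c
  obtain ⟨hi, hi'⟩ := integrable_integral_inv_norm_sq_stdGaussian hk
  obtain ⟨P, hPdef⟩ : ∃ P : ℝ → ℝ,
      P = fun q => q ^ 4 / 20 - q ^ 3 / 3 + q ^ 2 - 2 * q + q⁻¹ / 5 + 13 / 12 := ⟨_, rfl⟩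
  obtain ⟨hP, hP'⟩ := integrable_integral_rational_norm_sq_stdGaussian_le hk hPdef
  have hlog := integrable_log_norm_sq_div_stdGaussian hk
  have hprod := (hq.mul_prod hi).const_mul (k / (2 * v) : ℝ)
  have hpos : ∀ᵐ p ∂(gaussianReal 0 1).prod γ, 0 < ‖p.2‖ ^ 2 :=
    Measure.quasiMeasurePreserving_snd.ae (ae_norm_sq_pos_stdGaussian (k := k) (by lia))
  rw [← hΨ.map_eq, integral_map hΨ.aemeasurable (Measurable.aestronglyMeasurable (by
    unfold gaussDensity; fun_prop))]
  have hL := (hlog.comp_snd (gaussianReal 0 1)).const_mul (-1 / 2 : ℝ)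
  have hR := (hP.comp_snd (gaussianReal 0 1)).const_mul (1 / 2 : ℝ)
  have hC := integrable_const (μ := (gaussianReal 0 1).prod γ) (-Real.log (2 * Real.pi * v) / 2)
  calc _ = ∫ p, (-Real.log (2 * Real.pi * v) / 2 + -1 / 2 * Real.log (‖p.2‖ ^ 2 / k) -
          k / (2 * v) * ((y - μ - c * p.1) ^ 2 * (‖p.2‖ ^ 2)⁻¹)) ∂(gaussianReal 0 1).prod γ := by
        refine integral_congr_ae ?_
        filter_upwards [hpos] with p hp
        rw [(hstat p).2, (hstat p).1]
        push_cast
        rw [add_sub_cancel_right, log_gaussDensity _ _ (by positivity), mul_div_assoc,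
          ← mul_assoc, Real.log_mul (by positivity) (by positivity)]
        field_simp
        ring
    _ ≤ ∫ p, (-Real.log (2 * Real.pi * v) / 2 + 1 / 2 * P (‖p.2‖ ^ 2 / k) -
          k / (2 * v) * ((y - μ - c * p.1) ^ 2 * (‖p.2‖ ^ 2)⁻¹)) ∂(gaussianReal 0 1).prod γ := by
        refine integral_mono_ae ((hC.fun_add hL).sub hprod) ((hC.fun_add hR).sub hprod) ?_
        filter_upwards [hpos] with p hp
        have := neg_log_le_rational (div_pos hp hk0)
        rw [hPdef]
        linarith
    _ ≤ _ := by
        rw [integral_sub (hC.fun_add hR) hprod, integral_add hC hR, integral_const,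
          integral_const_mul, integral_const_mul, integral_prod_mul (fun m => (y - μ - c * m) ^ 2)
            (fun x : EuclideanSpace ℝ (Fin k) => (‖x‖ ^ 2)⁻¹), hq', hi', hc2,
          integral_fun_snd (μ := gaussianReal 0 1) fun x => P (‖x‖ ^ 2 / k),
           log_gaussDensity _ _ hv']
        simp only [probReal_univ, one_smul]
        have hd : (y - μ) ^ 2 / (2 * v) + 1 / 2 * (k / ((k + 1) * (k - 2))) ≤
            k / (2 * v) * (((y - μ) ^ 2 + v / (k + 1)) * (k - 2 : ℝ)⁻¹) := by
          rw [← sub_nonneg]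
          have : 0 ≤ (y - μ) ^ 2 / (v * (k - 2)) := by positivity
          convert this using 1
          field_simp
          ring
        linarith
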